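/- In the ring of formal power series ℤ[[q]], the following two identities hold: (i) ∑_{j=0}^{∞} q^{j(3j−1)/2} · (q²;q⁶)_j / (q;q)_{3j} = 1/((q;q³)_∞ (q⁵;q⁶)_∞); (ii) ∑_{j=0}^{∞} q^{j(3j+1)/2} · (q⁴;q⁶)_j / (q;q)_{3j+1} = 1/((q²;q³)_∞ (q;q⁶)_∞). -/

import Mathlib

open PowerSeries Finset

/-- The infinite product `∏_{i=0}^∞ (1 - q^(c + d·i))` as a formal power series in
`ℤ[[q]]` (for `c ≥ 1`, `d ≥ 1` the coefficient of `q^N` is already determined by the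
partial product of the first `N+1` factors, which is how it is defined here).
This is the `q`-Pochhammer symbol `(q^c; q^d)_∞`. -/
noncomputable def pochInf (c d : ℕ) : PowerSeries ℤ :=
  PowerSeries.mk fun N => PowerSeries.coeff N
    (∏ i ∈ Finset.range (N + 1), (1 - (X : PowerSeries ℤ) ^ (c + d * i)))

/-- The finite `q`-Pochhammer symbol `(q^c; q^d)_m = ∏_{i=0}^{m-1} (1 - q^(c + d·i))`
in `ℤ[[q]]`. -/
noncomputable def poch (c d m : ℕ) : PowerSeries ℤ :=
  ∏ i ∈ Finset.range m, (1 - (X : PowerSeries ℤ) ^ (c + d * i))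

/-- `∑_{j=0}^∞ q^{j(3j-1)/2} (q²;q⁶)_j / (q;q)_{3j}` as a power series in `ℤ[[q]]`:
the `j`-th term has order at least `j`, so the coefficient of `q^N` is that of the
partial sum of the first `N+1` terms.  `(q;q)_{3j}` has constant term `1`, and its
inverse is `invOfUnit _ 1`. -/
noncomputable def lhsA : PowerSeries ℤ :=
  PowerSeries.mk fun N => PowerSeries.coeff N
    (∑ j ∈ Finset.range (N + 1),
      (X : PowerSeries ℤ) ^ (j * (3 * j - 1) / 2) * poch 2 6 j *
        PowerSeries.invOfUnit (poch 1 1 (3 * j)) 1)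

/-- `∑_{j=0}^∞ q^{j(3j+1)/2} (q⁴;q⁶)_j / (q;q)_{3j+1}` as a power series in `ℤ[[q]]`. -/
noncomputable def lhsB : PowerSeries ℤ :=
  PowerSeries.mk fun N => PowerSeries.coeff N
    (∑ j ∈ Finset.range (N + 1),
      (X : PowerSeries ℤ) ^ (j * (3 * j + 1) / 2) * poch 4 6 j *
        PowerSeries.invOfUnit (poch 1 1 (3 * j + 1)) 1)

section generic

variable {R : Type*} [CommRing R]

lemma pow_zero_of_le {x : R} {M k : ℕ} (hx : x ^ M = 0) (h : M ≤ k) : x ^ k = 0 :=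
  pow_eq_zero_of_le h hx

/-- products of nilpotent perturbations stabilise -/
lemma prod_stab {x : R} {M : ℕ} (hx : x ^ M = 0) (b : R) (c d n : ℕ) (hc : 1 ≤ c) (hd : 1 ≤ d)
    (hn : M ≤ n) :
    ∏ i ∈ range n, (1 + b * x ^ (c + d * i)) = ∏ i ∈ range M, (1 + b * x ^ (c + d * i)) := by
  obtain ⟨k, rfl⟩ := Nat.exists_eq_add_of_le hn
  rw [prod_range_add]
  have : ∏ i ∈ range k, (1 + b * x ^ (c + d * (M + i))) = 1 := by
    apply prod_eq_one
    intro i _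
    rw [pow_zero_of_le hx (by nlinarith)]
    ring
  rw [this, mul_one]

lemma prod_stab_sub {x : R} {M : ℕ} (hx : x ^ M = 0) (c d n : ℕ) (hc : 1 ≤ c) (hd : 1 ≤ d)
    (hn : M ≤ n) :
    ∏ i ∈ range n, (1 - x ^ (c + d * i)) = ∏ i ∈ range M, (1 - x ^ (c + d * i)) := by
  have := prod_stab hx (-1) c d n hc hd hn
  simpa [sub_eq_add_neg] using this

noncomputable def GG (x a : R) (M : ℕ) (e : ℕ → R) (s : ℕ) : R :=
  ∑ j ∈ range M, e j * x ^ (3 * j.choose 2 + s * j) * (∏ i ∈ range j, (1 - a * x ^ (3 * i))) *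
    ∏ i ∈ range M, (1 + a * x ^ (s + 3 * j + 3 * i))

lemma GG_step {x a : R} {M : ℕ} (hx : x ^ M = 0) (e : ℕ → R)
    (he : ∀ j, e (j + 1) * (1 - x ^ (3 * (j + 1))) = e j) (s : ℕ) (hs : 1 ≤ s) :
    GG x a M e s = (1 + x ^ s) * GG x a M e (s + 3) := by
  unfold GG
  rcases M with _ | m
  · simp
  set M := m + 1 with hM
  -- tail product recursion
  have tail : ∀ j, ∏ i ∈ range M, (1 + a * x ^ (s + 3 * j + 3 * i)) =
      (1 + a * x ^ (s + 3 * j)) * ∏ i ∈ range M, (1 + a * x ^ (s + 3 + 3 * j + 3 * i)) := by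
    intro j
    rw [← prod_stab hx a (s + 3 * j) 3 (M + 1) (by omega) (by omega) (by omega), prod_range_succ',
      mul_comm]
    congr 1
    apply prod_congr rfl
    intro i _
    congr 3
    ring
  set T : ℕ → R := fun j => ∏ i ∈ range M, (1 + a * x ^ (s + 3 * j + 3 * i)) with hT
  set A : ℕ → R := fun j => ∏ i ∈ range j, (1 - a * x ^ (3 * i)) with hA
  have key : ∑ j ∈ range M, e j * x ^ (3 * j.choose 2 + s * j) * (1 - x ^ (3 * j)) * A j * T j =
      ∑ j ∈ range M, e j * x ^ (3 * j.choose 2 + (s + 3) * j) * x ^ s * A (j + 1) * T (j + 1) := by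
    rw [hM, sum_range_succ', sum_range_succ]
    have z : x ^ s * x ^ (3 * m.choose 2 + (s + 3) * m) = 0 := by
      rw [← pow_add]
      exact pow_zero_of_le hx (by nlinarith)
    have z' : e m * x ^ (3 * m.choose 2 + (s + 3) * m) * x ^ s * A (m + 1) * T (m + 1) = 0 := by
      linear_combination (e m * A (m + 1) * T (m + 1)) * z
    rw [z']
    simp only [mul_zero, pow_zero, sub_self, zero_mul, add_zero]
    apply sum_congr rfl
    intro j _
    rw [← he j, Nat.choose_succ_succ' j 1, Nat.choose_one_right]
    ring
  have hT1 : ∀ j, T (j + 1) = ∏ i ∈ range M, (1 + a * x ^ (s + 3 + 3 * j + 3 * i)) := by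
    intro j
    apply prod_congr rfl
    intro i _
    congr 3
    ring
  have split : ∑ j ∈ range M, e j * x ^ (3 * j.choose 2 + s * j) * A j * T j =
      ∑ j ∈ range M, e j * x ^ (3 * j.choose 2 + s * j) * (1 - x ^ (3 * j)) * A j * T j +
      ∑ j ∈ range M, e j * x ^ (3 * j.choose 2 + s * j) * x ^ (3 * j) * A j * T j := by
    rw [← sum_add_distrib]
    apply sum_congr rfl
    intro j _
    ring
  change ∑ j ∈ range M, e j * x ^ (3 * j.choose 2 + s * j) * A j * T j = _
  rw [split, key, ← sum_add_distrib, mul_sum]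
  apply sum_congr rfl
  intro j _
  have h1 : T j = (1 + a * x ^ (s + 3 * j)) * T (j + 1) := by rw [hT1]; exact tail j
  have h2 : A (j + 1) = A j * (1 - a * x ^ (3 * j)) := prod_range_succ _ _
  rw [← hT1, h1, h2]
  change _ = (1 + x ^ s) * (e j * x ^ (3 * j.choose 2 + (s + 3) * j) * A j * T (j + 1))
  ring

lemma GG_eq {x a : R} {M : ℕ} (hx : x ^ M = 0) (e : ℕ → R) (he0 : e 0 = 1)
    (he : ∀ j, e (j + 1) * (1 - x ^ (3 * (j + 1))) = e j) (s : ℕ) (hs : 1 ≤ s) :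
    GG x a M e s = ∏ i ∈ range M, (1 + x ^ (s + 3 * i)) := by
  have h : ∀ n, GG x a M e s = (∏ i ∈ range n, (1 + x ^ (s + 3 * i))) * GG x a M e (s + 3 * n) := by
    intro n
    induction n with
    | zero => simp
    | succ n ih =>
      rw [ih, GG_step hx e he _ (by omega), prod_range_succ, mul_assoc]
      rfl
  rw [h M]
  suffices H : GG x a M e (s + 3 * M) = 1 by rw [H, mul_one]
  unfold GG
  rcases M with _ | m
  · have : (1 : R) = 0 := by simpa using hx
    simp [this]
  rw [sum_range_succ', sum_eq_zero, zero_add]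
  · have hp : ∏ i ∈ range (m + 1), (1 + a * x ^ (s + 3 * (m + 1) + 3 * 0 + 3 * i)) = 1 := by
      apply prod_eq_one
      intro i _
      rw [pow_zero_of_le hx (by omega)]
      ring
    rw [hp]
    simp [he0]
  · intro j _
    rw [pow_zero_of_le hx (by nlinarith)]
    ring

lemma prod_three (f : ℕ → R) (j : ℕ) : ∏ i ∈ range (3 * j), f i =
    (∏ i ∈ range j, f (3 * i)) * (∏ i ∈ range j, f (3 * i + 1)) *
      ∏ i ∈ range j, f (3 * i + 2) := by
  induction j with
  | zero => simp
  | succ n ih =>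
    rw [show 3 * (n + 1) = 3 * n + 1 + 1 + 1 by ring]
    simp only [prod_range_succ, ih]
    ring

lemma prod_two (f : ℕ → R) (j : ℕ) : ∏ i ∈ range (2 * j), f i =
    (∏ i ∈ range j, f (2 * i)) * (∏ i ∈ range j, f (2 * i + 1)) := by
  induction j with
  | zero => simp
  | succ n ih =>
    rw [show 2 * (n + 1) = 2 * n + 1 + 1 by ring]
    simp only [prod_range_succ, ih]
    ring

/-- the product in `R` -/
def pp (x : R) (c d m : ℕ) : R := ∏ i ∈ range m, (1 - x ^ (c + d * i))

def pm (x : R) (c d m : ℕ) : R := ∏ i ∈ range m, (1 + x ^ (c + d * i))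

lemma pp_unit {x : R} {M : ℕ} (hx : x ^ M = 0) (c d m : ℕ) (hc : 1 ≤ c) : IsUnit (pp x c d m) := by
  unfold pp
  refine (Finset.prod_induction _ IsUnit (fun _ _ ha hb => ha.mul hb) isUnit_one ?_)
  intro i _
  apply IsNilpotent.isUnit_one_sub
  exact ⟨M, by rw [← pow_mul]; exact pow_zero_of_le hx (Nat.le_mul_of_pos_left _ (by omega))⟩

lemma pp_mul_pm (x : R) (c d m : ℕ) : pp x c d m * pm x c d m = pp x (2 * c) (2 * d) m := by
  unfold pp pm
  rw [← prod_mul_distrib]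
  apply prod_congr rfl
  intro i _
  ring

lemma pp_split2 (x : R) (c d m : ℕ) :
    pp x c d (2 * m) = pp x c (2 * d) m * pp x (c + d) (2 * d) m := by
  unfold pp
  rw [prod_two]
  congr 1 <;> (apply prod_congr rfl; intro i _; congr 2; ring)

lemma pp_split3 (x : R) (m : ℕ) :
    pp x 1 1 (3 * m) = pp x 1 3 m * pp x 2 3 m * pp x 3 3 m := by
  unfold pp
  rw [prod_three]
  congr 1
  · congr 1 <;> (apply prod_congr rfl; intro i _; congr 2; ring)
  · apply prod_congr rfl; intro i _; congr 2; ring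

lemma pp_add (x : R) (c d j m : ℕ) :
    pp x c d (j + m) = pp x c d j * pp x (c + d * j) d m := by
  unfold pp
  rw [prod_range_add]
  congr 1
  apply prod_congr rfl; intro i _; congr 2; ring

lemma pp_stab {x : R} {M : ℕ} (hx : x ^ M = 0) (c d n : ℕ) (hc : 1 ≤ c) (hd : 1 ≤ d)
    (hn : M ≤ n) : pp x c d n = pp x c d M := prod_stab_sub hx c d n hc hd hn

lemma expo (j : ℕ) : j * (3 * j - 1) / 2 = 3 * j.choose 2 + 1 * j ∧
    j * (3 * j + 1) / 2 = 3 * j.choose 2 + 2 * j := by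
  have h : j.choose 2 * 2 = j * (j - 1) := by
    rw [Nat.choose_two_right]
    exact Nat.div_mul_cancel (Nat.even_mul_pred_self j).two_dvd
  rcases j with _ | k
  · simp
  · simp only [Nat.add_sub_cancel] at h
    constructor
    · apply Nat.div_eq_of_eq_mul_left (by norm_num)
      rw [show 3 * (k + 1) - 1 = 3 * k + 2 by omega]
      linarith
    · apply Nat.div_eq_of_eq_mul_left (by norm_num)
      linarith

lemma e_rec {x : R} {M : ℕ} (hx : x ^ M = 0) {e : ℕ → R} (he : ∀ j, e j * pp x 3 3 j = 1) (j : ℕ) :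
    e (j + 1) * (1 - x ^ (3 * (j + 1))) = e j := by
  apply (pp_unit hx 3 3 j (by norm_num)).mul_right_cancel
  have h1 := he (j + 1)
  have h2 : pp x 3 3 (j + 1) = pp x 3 3 j * (1 - x ^ (3 + 3 * j)) := prod_range_succ _ _
  rw [h2] at h1
  rw [he]
  linear_combination h1

lemma genA {x : R} {M : ℕ} (hx : x ^ M = 0) (e u : ℕ → R) (he : ∀ j, e j * pp x 3 3 j = 1)
    (hu : ∀ j, u j * pp x 1 1 (3 * j) = 1) :
    (∑ j ∈ range M, x ^ (j * (3 * j - 1) / 2) * pp x 2 6 j * u j) *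
      (pp x 1 3 M * pp x 5 6 M) = 1 := by
  have hG := GG_eq (a := -x) hx e (by simpa [pp] using he 0) (e_rec hx he) 1 le_rfl
  have h1 : (∑ j ∈ range M, x ^ (j * (3 * j - 1) / 2) * pp x 2 6 j * u j) * pp x 2 3 M
      = pm x 1 3 M := by
    unfold pm
    rw [← hG, GG, sum_mul]
    apply sum_congr rfl
    intro j _
    have a1 : ∏ i ∈ range j, (1 - -x * x ^ (3 * i)) = pm x 1 3 j := by
      apply prod_congr rfl; intro i _; ring
    have a2 : ∏ i ∈ range M, (1 + -x * x ^ (1 + 3 * j + 3 * i)) = pp x (2 + 3 * j) 3 M := by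
      apply prod_congr rfl; intro i _; ring
    rw [a1, a2, (expo j).1, ← pp_stab hx 2 3 (j + M) (by norm_num) (by norm_num) (by omega), pp_add,
      ← pp_mul_pm x 1 3 j]
    have a3 : u j * pp x 1 3 j * pp x 2 3 j = e j := by
      apply (pp_unit hx 3 3 j (by norm_num)).mul_right_cancel
      rw [he, ← hu j, pp_split3]
      ring
    rw [← a3]
    ring
  apply (pp_unit hx 2 6 M (by norm_num)).mul_right_cancel
  have h2 := pp_split2 x 2 3 M
  rw [pp_stab hx 2 3 (2 * M) (by norm_num) (by norm_num) (by omega)] at h2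
  have h3 := pp_mul_pm x 1 3 M
  norm_num at h2 h3
  rw [h2] at h1
  linear_combination (pp x 1 3 M) * h1 + h3

lemma genB {x : R} {M : ℕ} (hx : x ^ M = 0) (e u : ℕ → R) (he : ∀ j, e j * pp x 3 3 j = 1)
    (hu : ∀ j, u j * pp x 1 1 (3 * j + 1) = 1) :
    (∑ j ∈ range M, x ^ (j * (3 * j + 1) / 2) * pp x 4 6 j * u j) *
      (pp x 2 3 M * pp x 1 6 M) = 1 := by
  have hG := GG_eq (a := -x ^ 2) hx e (by simpa [pp] using he 0) (e_rec hx he) 2 (by norm_num)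
  have h1 : (∑ j ∈ range M, x ^ (j * (3 * j + 1) / 2) * pp x 4 6 j * u j) * pp x 1 3 M
      = pm x 2 3 M := by
    unfold pm
    rw [← hG, GG, sum_mul]
    apply sum_congr rfl
    intro j _
    have a1 : ∏ i ∈ range j, (1 - -x ^ 2 * x ^ (3 * i)) = pm x 2 3 j := by
      apply prod_congr rfl; intro i _; ring
    have a2 : ∏ i ∈ range M, (1 + -x ^ 2 * x ^ (2 + 3 * j + 3 * i)) =
        pp x (1 + 3 * (j + 1)) 3 M := by
      apply prod_congr rfl; intro i _; ring
    rw [a1, a2, (expo j).2, ← pp_stab hx 1 3 (j + 1 + M) (by norm_num) (by norm_num) (by omega),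
      pp_add, ← pp_mul_pm x 2 3 j]
    have a3 : u j * pp x 1 3 (j + 1) * pp x 2 3 j = e j := by
      apply (pp_unit hx 3 3 j (by norm_num)).mul_right_cancel
      have b1 : pp x 1 1 (3 * j + 1) = pp x 1 1 (3 * j) * (1 - x ^ (1 + 1 * (3 * j))) :=
        prod_range_succ _ _
      have b2 : pp x 1 3 (j + 1) = pp x 1 3 j * (1 - x ^ (1 + 3 * j)) := prod_range_succ _ _
      rw [he, ← hu j, b1, b2, pp_split3]
      ring
    rw [← a3]
    ring
  apply (pp_unit hx 4 6 M (by norm_num)).mul_right_cancel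
  have h2 := pp_split2 x 1 3 M
  rw [pp_stab hx 1 3 (2 * M) (by norm_num) (by norm_num) (by omega)] at h2
  have h3 := pp_mul_pm x 2 3 M
  norm_num at h2 h3
  rw [h2] at h1
  linear_combination (pp x 2 3 M) * h1 + h3

end generic

/-- reduction mod `X^M` -/
noncomputable def redm (M : ℕ) : PowerSeries ℤ →+* (PowerSeries ℤ ⧸ Ideal.span {(X : PowerSeries ℤ) ^ M}) :=
  Ideal.Quotient.mk _

lemma redm_eq_iff (M : ℕ) (f g : PowerSeries ℤ) :
    redm M f = redm M g ↔ ∀ k < M, coeff k f = coeff k g := by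
  unfold redm
  rw [Ideal.Quotient.mk_eq_mk_iff_sub_mem, Ideal.mem_span_singleton, X_pow_dvd_iff]
  simp [sub_eq_zero]

lemma redm_X (M : ℕ) : (redm M X) ^ M = 0 := by
  rw [← map_pow]
  exact Ideal.Quotient.eq_zero_iff_mem.2 (Ideal.mem_span_singleton_self _)

lemma redm_poch (M c d m : ℕ) : redm M (poch c d m) = pp (redm M X) c d m := by
  simp [poch, pp]

lemma redm_pochInf (M c d : ℕ) (hc : 1 ≤ c) (hd : 1 ≤ d) :
    redm M (pochInf c d) = pp (redm M X) c d M := by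
  rw [← redm_poch, redm_eq_iff]
  intro k hk
  rw [pochInf, coeff_mk]
  refine (redm_eq_iff (k + 1) (poch c d (k + 1)) (poch c d M)).1 ?_ k (by omega)
  rw [redm_poch, redm_poch, pp_stab (redm_X _) c d M hc hd (by omega)]

lemma redm_sum (M : ℕ) (t : ℕ → PowerSeries ℤ) (ht : ∀ j, (X : PowerSeries ℤ) ^ j ∣ t j) :
    redm M (PowerSeries.mk fun N => coeff N (∑ j ∈ range (N + 1), t j)) =
      redm M (∑ j ∈ range M, t j) := by
  rw [redm_eq_iff]
  intro k hk
  rw [coeff_mk]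
  obtain ⟨n, rfl⟩ := Nat.exists_eq_add_of_le (show k + 1 ≤ M by omega)
  rw [sum_range_add t (k + 1) n, map_add, map_sum (coeff k) _ (range n), sum_eq_zero (s := range n), add_zero]
  intro i _
  exact X_pow_dvd_iff.1 (ht (k + 1 + i)) k (by omega)

lemma poch_inv (c d m : ℕ) (hc : 1 ≤ c) : invOfUnit (poch c d m) 1 * poch c d m = 1 := by
  rw [mul_comm]
  apply mul_invOfUnit
  simp only [poch, map_prod, Units.val_one]
  apply prod_eq_one
  intro i _
  simp
  omega

lemma eq_one_of_redm {f : PowerSeries ℤ} (h : ∀ M, redm M f = 1) : f = 1 := by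
  ext k
  exact (redm_eq_iff (k + 1) f 1).1 (by rw [h, map_one]) k (by omega)

theorem corteel_savage_sills :
    lhsA * (pochInf 1 3 * pochInf 5 6) = 1 ∧
    lhsB * (pochInf 2 3 * pochInf 1 6) = 1 := by
  have he : ∀ M j, redm M (invOfUnit (poch 3 3 j) 1) * pp (redm M X) 3 3 j = 1 := by
    intro M j
    rw [← redm_poch, ← map_mul, poch_inv _ _ _ (by norm_num), map_one]
  constructor
  · apply eq_one_of_redm
    intro M
    rw [map_mul, map_mul, redm_pochInf _ _ _ (by norm_num) (by norm_num),
      redm_pochInf _ _ _ (by norm_num) (by norm_num), lhsA, redm_sum]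
    · rw [map_sum]
      simp only [map_mul, map_pow, redm_poch]
      apply genA (redm_X M) _ _ (he M)
      intro j
      rw [← redm_poch, ← map_mul, poch_inv _ _ _ (by norm_num), map_one]
    · intro j
      rw [mul_assoc, (expo j).1]
      exact Dvd.dvd.mul_right (pow_dvd_pow _ (by omega)) _
  · apply eq_one_of_redm
    intro M
    rw [map_mul, map_mul, redm_pochInf _ _ _ (by norm_num) (by norm_num),
      redm_pochInf _ _ _ (by norm_num) (by norm_num), lhsB, redm_sum]
    · rw [map_sum]
      simp only [map_mul, map_pow, redm_poch]
      apply genB (redm_X M) _ _ (he M)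
      intro j
      rw [← redm_poch, ← map_mul, poch_inv _ _ _ (by norm_num), map_one]
    · intro j
      rw [mul_assoc, (expo j).2]
      exact Dvd.dvd.mul_right (pow_dvd_pow _ (by omega)) _
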